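/- arXiv:1308.2281 — 3 statements merged into one kernel-verified Lean document; each statement's English description precedes it below -/
import Mathlib

section
/- Let p, q ≥ 3 and n ≥ 0 be integers. If at least one of p and q is even, then the determinant of the distance matrix of G(p,q;n) equals 0; and if both p and q are odd, then the determinant of the distance matrix of G(p,q;n) equals ((pq−1)(p+q)/4 + (n/2)·p·q)·(−2)^n (as a rational number). -/
open SimpleGraph Matrix

/-- The distance matrix of a graph, with entries in `ℚ`: the `(i,j)` entry is the
graph distance (length of a shortest path) between `i` and `j`. -/
noncomputable def distMatrix {V : Type*} (G : SimpleGraph V) : Matrix V V ℚ :=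
  fun i j => (G.dist i j : ℚ)

/-- The graph `G(p,q;n)` on `Fin (p+q-1+n)`: the graph `∞(p,1,q)` — the cycle `C_p`
on `0, …, p-1` and the cycle `C_q` on `0, p, …, p+q-2`, sharing the center vertex
`0` — together with a pendant path `0, p+q-1, p+q, …, p+q-2+n` on `n` new vertices
planted at the center vertex.  In particular `G(p,q;0) = ∞(p,1,q)`. -/
def Gpq (p q n : ℕ) : SimpleGraph (Fin (p + q - 1 + n)) :=
  SimpleGraph.fromRel (fun a b =>
    ((a : ℕ) + 1 = (b : ℕ) ∧ (b : ℕ) < p) ∨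
    ((a : ℕ) = 0 ∧ (b : ℕ) = p - 1) ∨
    ((a : ℕ) = 0 ∧ (b : ℕ) = p) ∨
    (p ≤ (a : ℕ) ∧ (a : ℕ) + 1 = (b : ℕ) ∧ (b : ℕ) ≤ p + q - 2) ∨
    ((a : ℕ) = 0 ∧ (b : ℕ) = p + q - 2) ∨
    (1 ≤ n ∧ (a : ℕ) = 0 ∧ (b : ℕ) = p + q - 1) ∨
    (p + q - 1 ≤ (a : ℕ) ∧ (a : ℕ) + 1 = (b : ℕ)))

theorem SimpleGraph.dist_eq_of_potential {V : Type*} (G : SimpleGraph V) (δ : V → V → ℕ)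
    (hzero : ∀ a b, δ a b = 0 ↔ a = b)
    (hlip : ∀ a b c, G.Adj b c → δ a c ≤ δ a b + 1)
    (hstep : ∀ a b, a ≠ b → ∃ c, G.Adj c b ∧ δ a b = δ a c + 1) (a b : V) :
    G.dist a b = δ a b := by
  have hlow : ∀ {b c : V} (w : G.Walk b c), δ a c ≤ δ a b + w.length := by
    intro b c w
    induction w with
    | nil => simp
    | cons h w ih =>
      have := hlip a _ _ h
      rw [Walk.length_cons]
      omega
  have hup : ∀ n b, δ a b = n → ∃ w : G.Walk a b, w.length = n := by
    intro n
    induction n with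
    | zero =>
      intro b hb
      obtain rfl := (hzero a b).1 hb
      exact ⟨Walk.nil, rfl⟩
    | succ n ih =>
      intro b hb
      obtain ⟨c, hc, h⟩ := hstep a b (fun h => by have := (hzero a b).2 h; omega)
      obtain ⟨w, hw⟩ := ih c (by omega)
      exact ⟨w.concat hc, by rw [Walk.length_concat, hw]⟩
  obtain ⟨w, hw⟩ := hup _ b rfl
  obtain ⟨w', hw'⟩ := w.reachable.exists_walk_length_eq_dist
  have h1 := hlow w'
  have h2 := dist_le w
  rw [(hzero a a).2 rfl] at h1
  omega

/-- The distance between positions `x` and `y` on a cycle of length `p`. -/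
def cycleDist (p x y : ℕ) : ℕ := min ((x - y) + (y - x)) (p - ((x - y) + (y - x)))

/-- Adjacency of positions `x` and `y` on a cycle of length `p`. -/
def cycleAdj (p x y : ℕ) : Prop :=
  x < p ∧ y < p ∧ (x + 1 = y ∨ y + 1 = x ∨ (x = 0 ∧ y = p - 1) ∨ (y = 0 ∧ x = p - 1))

theorem cycleDist_le_of_adj {p x y z : ℕ} (hx : x < p) (h : cycleAdj p y z) :
    cycleDist p x z ≤ cycleDist p x y + 1 := by
  obtain ⟨hy, hz, h⟩ := h
  unfold cycleDist
  omega

theorem exists_cycleAdj_cycleDist {p x y : ℕ} (hx : x < p) (hy : y < p) (h : x ≠ y) :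
    ∃ z, cycleAdj p z y ∧ cycleDist p x y = cycleDist p x z + 1 := by
  unfold cycleDist cycleAdj
  rcases Nat.lt_or_gt_of_ne h with h | h
  · by_cases h2 : 2 * (y - x) ≤ p
    · exact ⟨y - 1, by omega, by omega⟩
    · by_cases h3 : y = p - 1
      · exact ⟨0, by omega, by omega⟩
      · exact ⟨y + 1, by omega, by omega⟩
  · by_cases h2 : 2 * (x - y) ≤ p
    · exact ⟨y + 1, by omega, by omega⟩
    · by_cases h3 : y = 0
      · exact ⟨p - 1, by omega, by omega⟩
      · exact ⟨y - 1, by omega, by omega⟩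

/-- The position on the first cycle of the vertex `a` of `G(p,q;n)`. -/
def coordP (p a : ℕ) : ℕ := if a < p then a else 0

/-- The position on the second cycle of the vertex `a` of `G(p,q;n)`. -/
def coordQ (p q a : ℕ) : ℕ := if p ≤ a ∧ a ≤ p + q - 2 then a - (p - 1) else 0

/-- The position on the pendant path of the vertex `a` of `G(p,q;n)`. -/
def coordN (p q a : ℕ) : ℕ := a - (p + q - 2)

theorem coord_cases {p q : ℕ} (hp : 3 ≤ p) (hq : 3 ≤ q) (a : ℕ) :
    (a < p ∧ coordP p a = a ∧ coordQ p q a = 0 ∧ coordN p q a = 0) ∨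
    (p ≤ a ∧ a ≤ p + q - 2 ∧ coordP p a = 0 ∧ coordQ p q a = a - (p - 1) ∧
      coordN p q a = 0) ∨
    (p + q - 2 < a ∧ coordP p a = 0 ∧ coordQ p q a = 0 ∧
      coordN p q a = a - (p + q - 2)) := by
  unfold coordP coordQ coordN
  split_ifs <;> omega

/-- The distance in `G(p,q;n)`, in terms of coordinates on the two cycles and on the path. -/
def gpqDist (p q a b : ℕ) : ℕ :=
  cycleDist p (coordP p a) (coordP p b) + cycleDist q (coordQ p q a) (coordQ p q b) +
    ((coordN p q a - coordN p q b) + (coordN p q b - coordN p q a))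

theorem coordP_lt {p q : ℕ} (hp : 3 ≤ p) (hq : 3 ≤ q) (a : ℕ) : coordP p a < p := by
  have := coord_cases hp hq a
  omega

theorem coordQ_lt {p q : ℕ} (hp : 3 ≤ p) (hq : 3 ≤ q) (a : ℕ) : coordQ p q a < q := by
  have := coord_cases hp hq a
  omega

theorem cycleDist_eq_zero {p x y : ℕ} (hx : x < p) (hy : y < p) :
    cycleDist p x y = 0 ↔ x = y := by
  unfold cycleDist
  omega

theorem gpqDist_eq_zero {p q : ℕ} (hp : 3 ≤ p) (hq : 3 ≤ q) (a b : ℕ) :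
    gpqDist p q a b = 0 ↔ a = b := by
  have h1 := cycleDist_eq_zero (coordP_lt hp hq a) (coordP_lt hp hq b)
  have h2 := cycleDist_eq_zero (coordQ_lt hp hq a) (coordQ_lt hp hq b)
  constructor
  · intro h
    unfold gpqDist at h
    have h1 := h1.1 (by omega)
    have h2 := h2.1 (by omega)
    have ha := coord_cases hp hq a
    have hb := coord_cases hp hq b
    omega
  · rintro rfl
    unfold gpqDist
    rw [h1.2 rfl, h2.2 rfl]
    omega

/-- Two vertices whose coordinates are adjacent in one factor and agree in the others. -/
def CoordAdj (p q b c : ℕ) : Prop :=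
  (cycleAdj p (coordP p b) (coordP p c) ∧ coordQ p q b = coordQ p q c ∧
    coordN p q b = coordN p q c) ∨
  (cycleAdj q (coordQ p q b) (coordQ p q c) ∧ coordP p b = coordP p c ∧
    coordN p q b = coordN p q c) ∨
  ((coordN p q b + 1 = coordN p q c ∨ coordN p q c + 1 = coordN p q b) ∧
    coordP p b = coordP p c ∧ coordQ p q b = coordQ p q c)

theorem CoordAdj.symm {p q b c : ℕ} (h : CoordAdj p q b c) : CoordAdj p q c b := by
  rcases h with ⟨⟨h1, h2, h3⟩, h4, h5⟩ | ⟨⟨h1, h2, h3⟩, h4, h5⟩ | ⟨h3, h4, h5⟩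
  · exact .inl ⟨⟨h2, h1, by omega⟩, h4.symm, h5.symm⟩
  · exact .inr (.inl ⟨⟨h2, h1, by omega⟩, h4.symm, h5.symm⟩)
  · exact .inr (.inr ⟨h3.symm, h4.symm, h5.symm⟩)

theorem coordAdj_of_rel {p q n b c : ℕ} (hp : 3 ≤ p) (hq : 3 ≤ q)
    (h : (b + 1 = c ∧ c < p) ∨ (b = 0 ∧ c = p - 1) ∨ (b = 0 ∧ c = p) ∨
      (p ≤ b ∧ b + 1 = c ∧ c ≤ p + q - 2) ∨ (b = 0 ∧ c = p + q - 2) ∨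
      (1 ≤ n ∧ b = 0 ∧ c = p + q - 1) ∨ (p + q - 1 ≤ b ∧ b + 1 = c)) :
    CoordAdj p q b c := by
  have hb := coord_cases hp hq b
  have hc := coord_cases hp hq c
  unfold CoordAdj cycleAdj
  rcases h with h | h | h | h | h | h | h
  · exact .inl ⟨⟨by omega, by omega, by omega⟩, by omega, by omega⟩
  · exact .inl ⟨⟨by omega, by omega, by omega⟩, by omega, by omega⟩
  · exact .inr (.inl ⟨⟨by omega, by omega, by omega⟩, by omega, by omega⟩)
  · exact .inr (.inl ⟨⟨by omega, by omega, by omega⟩, by omega, by omega⟩)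
  · exact .inr (.inl ⟨⟨by omega, by omega, by omega⟩, by omega, by omega⟩)
  · exact .inr (.inr ⟨by omega, by omega, by omega⟩)
  · exact .inr (.inr ⟨by omega, by omega, by omega⟩)

theorem coordAdj_of_adj {p q n : ℕ} (hp : 3 ≤ p) (hq : 3 ≤ q)
    {b c : Fin (p + q - 1 + n)} (h : (Gpq p q n).Adj b c) : CoordAdj p q b c := by
  rw [Gpq, fromRel_adj] at h
  obtain ⟨-, h | h⟩ := h
  · exact coordAdj_of_rel hp hq h
  · exact (coordAdj_of_rel hp hq h).symm

theorem gpqDist_le_of_adj {p q n : ℕ} (hp : 3 ≤ p) (hq : 3 ≤ q) (a : ℕ)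
    {b c : Fin (p + q - 1 + n)} (h : (Gpq p q n).Adj b c) :
    gpqDist p q a c ≤ gpqDist p q a b + 1 := by
  unfold gpqDist
  rcases coordAdj_of_adj hp hq h with ⟨h1, h2, h3⟩ | ⟨h1, h2, h3⟩ | ⟨h1, h2, h3⟩
  · have := cycleDist_le_of_adj (coordP_lt hp hq a) h1
    rw [h2, h3]
    omega
  · have := cycleDist_le_of_adj (coordQ_lt hp hq a) h1
    rw [h2, h3]
    omega
  · rw [h2, h3]
    omega

theorem exists_adj_gpqDist {p q n : ℕ} (hp : 3 ≤ p) (hq : 3 ≤ q)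
    {a b : Fin (p + q - 1 + n)} (h : a ≠ b) :
    ∃ c : Fin (p + q - 1 + n), (Gpq p q n).Adj c b ∧
      gpqDist p q a b = gpqDist p q a c + 1 := by
  have hne : (a : ℕ) ≠ b := fun h' => h (Fin.ext h')
  have ha := coord_cases hp hq a
  have hb := coord_cases hp hq b
  have ha2 := a.2
  have hb2 := b.2
  have hcase : (coordP p a ≠ coordP p b ∧ coordQ p q b = 0 ∧ coordN p q b = 0) ∨
      (coordQ p q a ≠ coordQ p q b ∧ coordP p b = 0 ∧ coordN p q b = 0) ∨
      (coordN p q a ≠ coordN p q b ∧ coordP p b = 0 ∧ coordQ p q b = 0) := by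
    omega
  rcases hcase with ⟨h1, h2, h3⟩ | ⟨h1, h2, h3⟩ | ⟨h1, h2, h3⟩
  · obtain ⟨z, hz, hd⟩ := exists_cycleAdj_cycleDist (coordP_lt hp hq a) (coordP_lt hp hq b) h1
    have hb' : coordP p b = b := by omega
    rw [hb'] at hz
    obtain ⟨hz1, hz2, hz3⟩ := hz
    obtain ⟨v, hv⟩ : ∃ v : Fin (p + q - 1 + n), (v : ℕ) = z := ⟨⟨z, by omega⟩, rfl⟩
    refine ⟨v, ?_, ?_⟩
    · rw [Gpq, fromRel_adj, ne_eq, Fin.ext_iff]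
      refine ⟨by omega, ?_⟩
      rcases hz3 with h | h | h | h
      · exact .inl (.inl ⟨by omega, by omega⟩)
      · exact .inr (.inl ⟨by omega, by omega⟩)
      · exact .inl (.inr (.inl ⟨by omega, by omega⟩))
      · exact .inr (.inr (.inl ⟨by omega, by omega⟩))
    · have hc := coord_cases hp hq z
      have e1 : coordP p z = z := by omega
      have e2 : coordQ p q z = coordQ p q b := by omega
      have e3 : coordN p q z = coordN p q b := by omega
      unfold gpqDist
      rw [hv, e1, e2, e3, hd]
      omega
  · obtain ⟨z, hz, hd⟩ := exists_cycleAdj_cycleDist (coordQ_lt hp hq a) (coordQ_lt hp hq b) h1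
    obtain ⟨hz1, hz2, hz3⟩ := hz
    obtain ⟨c, hc1, hc2, e1, e2, e3⟩ : ∃ c, c ≤ p + q - 2 ∧
        (c = 0 ∧ z = 0 ∨ p ≤ c ∧ c = z + (p - 1)) ∧
        coordP p c = 0 ∧ coordQ p q c = z ∧ coordN p q c = 0 := by
      by_cases h0 : z = 0
      · have := coord_cases hp hq 0
        exact ⟨0, by omega, by omega, by omega, by omega, by omega⟩
      · have := coord_cases hp hq (z + (p - 1))
        exact ⟨z + (p - 1), by omega, by omega, by omega, by omega, by omega⟩
    obtain ⟨v, hv⟩ : ∃ v : Fin (p + q - 1 + n), (v : ℕ) = c := ⟨⟨c, by omega⟩, rfl⟩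
    refine ⟨v, ?_, ?_⟩
    · rw [Gpq, fromRel_adj, ne_eq, Fin.ext_iff]
      refine ⟨by omega, ?_⟩
      rcases hz3 with h | h | h | h
      · by_cases h0 : z = 0
        · exact .inl (.inr (.inr (.inl ⟨by omega, by omega⟩)))
        · exact .inl (.inr (.inr (.inr (.inl ⟨by omega, by omega, by omega⟩))))
      · by_cases h0 : coordQ p q b = 0
        · exact .inr (.inr (.inr (.inl ⟨by omega, by omega⟩)))
        · exact .inr (.inr (.inr (.inr (.inl ⟨by omega, by omega, by omega⟩))))
      · exact .inl (.inr (.inr (.inr (.inr (.inl ⟨by omega, by omega⟩)))))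
      · exact .inr (.inr (.inr (.inr (.inr (.inl ⟨by omega, by omega⟩)))))
    · unfold gpqDist
      rw [hv, e1, e2, e3, hd, h2, h3]
      omega
  · obtain ⟨z, hz, hd⟩ : ∃ z,
        (z + 1 = coordN p q b ∨ coordN p q b + 1 = z ∧ coordN p q b < coordN p q a) ∧
        (coordN p q a - coordN p q b) + (coordN p q b - coordN p q a) =
        (coordN p q a - z) + (z - coordN p q a) + 1 := by
      rcases Nat.lt_or_gt_of_ne h1 with h | h
      · exact ⟨coordN p q b - 1, by omega, by omega⟩
      · exact ⟨coordN p q b + 1, by omega, by omega⟩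
    obtain ⟨c, hc1, hc2, e1, e2, e3⟩ : ∃ c, c < p + q - 1 + n ∧
        (c = 0 ∧ z = 0 ∨ p + q - 1 ≤ c ∧ c = z + (p + q - 2)) ∧
        coordP p c = 0 ∧ coordQ p q c = 0 ∧ coordN p q c = z := by
      by_cases h0 : z = 0
      · have := coord_cases hp hq 0
        exact ⟨0, by omega, by omega, by omega, by omega, by omega⟩
      · have := coord_cases hp hq (z + (p + q - 2))
        exact ⟨z + (p + q - 2), by omega, by omega, by omega, by omega, by omega⟩
    obtain ⟨v, hv⟩ : ∃ v : Fin (p + q - 1 + n), (v : ℕ) = c := ⟨⟨c, hc1⟩, rfl⟩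
    refine ⟨v, ?_, ?_⟩
    · rw [Gpq, fromRel_adj, ne_eq, Fin.ext_iff]
      refine ⟨by omega, ?_⟩
      rcases hz with h | h
      · by_cases h0 : z = 0
        · exact .inl (.inr (.inr (.inr (.inr (.inr (.inl ⟨by omega, by omega, by omega⟩))))))
        · exact .inl (.inr (.inr (.inr (.inr (.inr (.inr ⟨by omega, by omega⟩))))))
      · by_cases h0 : coordN p q b = 0
        · exact .inr (.inr (.inr (.inr (.inr (.inr (.inl ⟨by omega, by omega, by omega⟩))))))
        · exact .inr (.inr (.inr (.inr (.inr (.inr (.inr ⟨by omega, by omega⟩))))))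
    · unfold gpqDist
      rw [hv, e1, e2, e3, hd, h2, h3]
      omega

theorem distMatrix_Gpq {p q n : ℕ} (hp : 3 ≤ p) (hq : 3 ≤ q) (a b : Fin (p + q - 1 + n)) :
    distMatrix (Gpq p q n) a b = gpqDist p q a b := by
  rw [distMatrix, dist_eq_of_potential (Gpq p q n) (fun a b => gpqDist p q a b)
    (fun a b => (gpqDist_eq_zero hp hq a b).trans Fin.ext_iff.symm)
    (fun a _ _ h => gpqDist_le_of_adj hp hq a h) (fun _ _ h => exists_adj_gpqDist hp hq h)]

theorem det_of_cone {ι : Type*} [Fintype ι] [DecidableEq ι] (D : Matrix (Unit ⊕ ι) (Unit ⊕ ι) ℚ)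
    (M : Matrix ι ι ℚ) (r y : ι → ℚ) (h00 : D (.inl ()) (.inl ()) = 0)
    (h01 : ∀ i, D (.inl ()) (.inr i) = r i) (h10 : ∀ i, D (.inr i) (.inl ()) = r i)
    (h11 : ∀ i j, D (.inr i) (.inr j) = M i j + r i + r j) (hy : M *ᵥ y = r) :
    D.det = -(r ⬝ᵥ y) * M.det := by
  have hD : D = fromBlocks 1 0 (replicateCol Unit 1) 1 *
      fromBlocks 0 (replicateRow Unit r) (replicateCol Unit r) M *
      fromBlocks 1 (replicateRow Unit 1) 0 1 := by
    rw [fromBlocks_multiply, fromBlocks_multiply]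
    ext (i | i) (j | j)
    · simp [h00]
    · simp [h01]
    · simp [h10]
    · simp [h11, Matrix.mul_apply]
      ring
  have hB : fromBlocks 0 (replicateRow Unit r) (replicateCol Unit r) M *
      fromBlocks 1 0 (replicateCol Unit (-y)) 1 =
      fromBlocks (replicateRow Unit r * replicateCol Unit (-y)) (replicateRow Unit r) 0 M := by
    rw [fromBlocks_multiply]
    have : M * replicateCol Unit (-y) = replicateCol Unit (-r) := by
      rw [← hy, ← mulVec_neg, replicateCol_mulVec]
    rw [this]
    congr 1
    · simp
    · simp
    · ext i j
      simp
    · simp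
  have hdet := congrArg det hB
  rw [det_mul, det_fromBlocks_zero₁₂, det_fromBlocks_zero₂₁] at hdet
  rw [hD, det_mul, det_mul, det_fromBlocks_zero₁₂, det_fromBlocks_zero₂₁]
  simpa [Matrix.mul_apply, dotProduct] using hdet

/-- The tridiagonal matrix with `2` on the diagonal and `1` next to it. -/
def tridiag (n : ℕ) : Matrix (Fin n) (Fin n) ℚ := fun i j =>
  (if (i : ℕ) = j then 2 else 0) + (if (i : ℕ) + 1 = j then 1 else 0) +
    (if (i : ℕ) = j + 1 then 1 else 0)

theorem sum_mul_tridiag (n : ℕ) (F : ℕ → ℚ) (h0 : F 0 = 0) (h1 : F (n + 1) = 0) (j : Fin n) :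
    ∑ l : Fin n, F (l + 1) * tridiag n l j = F j + 2 * F (j + 1) + F (j + 2) := by
  have hj := j.2
  simp only [tridiag]
  rw [Fin.sum_univ_eq_sum_range (fun l => F (l + 1) * ((if l = (j : ℕ) then 2 else 0) +
    (if l + 1 = (j : ℕ) then 1 else 0) + (if l = (j : ℕ) + 1 then 1 else 0))) n]
  simp only [mul_add, Finset.sum_add_distrib, mul_ite, mul_zero, mul_one]
  rw [Finset.sum_ite_eq', Finset.sum_ite_eq', if_pos (Finset.mem_range.2 hj)]
  have hA : ∑ l ∈ Finset.range n, (if l + 1 = (j : ℕ) then F (l + 1) else 0) = F j := by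
    rcases Nat.eq_zero_or_pos (j : ℕ) with h | h
    · simp [h, h0]
    · obtain ⟨k, hk⟩ : ∃ k, (j : ℕ) = k + 1 := ⟨j - 1, by omega⟩
      simp only [hk, Nat.add_right_cancel_iff]
      rw [Finset.sum_ite_eq', if_pos (Finset.mem_range.2 (by omega))]
  have hB : (if (j : ℕ) + 1 ∈ Finset.range n then F (j + 1 + 1) else 0) = F (j + 2) := by
    split_ifs with h
    · rfl
    · rw [Finset.mem_range] at h
      rw [show (j : ℕ) + 2 = n + 1 by omega, h1]
  rw [hA, hB]
  ring

theorem det_tridiag (n : ℕ) : (tridiag n).det = n + 1 := by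
  let N : Matrix (Fin n) (Fin n) ℚ := fun i j =>
    (if (j : ℕ) = i then 1 else 0) + (if (j : ℕ) = i + 1 then 1 else 0)
  let u : Fin n → ℚ := fun i => (-1) ^ (i : ℕ)
  have hrow : ∀ (F : ℕ → ℚ) (i : Fin n), ∑ j, N i j * F j =
      F i + if (i : ℕ) + 1 < n then F (i + 1) else 0 := by
    intro F i
    simp only [N]
    rw [Fin.sum_univ_eq_sum_range (fun j => ((if j = (i : ℕ) then 1 else 0) +
      (if j = (i : ℕ) + 1 then 1 else 0)) * F j) n]
    simp only [add_mul, Finset.sum_add_distrib, ite_mul, zero_mul, one_mul]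
    rw [Finset.sum_ite_eq', Finset.sum_ite_eq', if_pos (Finset.mem_range.2 i.2)]
    simp
  have hN : N.det = 1 := by
    rw [det_of_isUpperTriangular]
    · simp [N]
    · intro i j hij
      have : (j : ℕ) < i := hij
      simp only [N]
      rw [if_neg (by omega), if_neg (by omega), add_zero]
  have hNu : N *ᵥ u = fun i : Fin n => if (i : ℕ) + 1 < n then 0 else (-1) ^ (i : ℕ) := by
    ext i
    rw [mulVec, dotProduct, hrow (fun j => (-1) ^ j)]
    split_ifs <;> ring
  have hT : tridiag n = N * (1 + replicateCol Unit u * replicateRow Unit u) * Nᵀ := by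
    have : N * (1 + replicateCol Unit u * replicateRow Unit u) * Nᵀ =
        N * Nᵀ + vecMulVec (N *ᵥ u) (N *ᵥ u) := by
      rw [mul_add, mul_one, add_mul, ← Matrix.mul_assoc, ← replicateCol_mulVec, Matrix.mul_assoc,
        ← replicateRow_vecMul, vecMul_transpose, vecMulVec_eq Unit]
    rw [this, hNu]
    ext i j
    have hi := i.2
    have hj := j.2
    rw [Matrix.add_apply, mul_apply, vecMulVec_apply]
    simp only [transpose_apply]
    have := hrow (fun l => (if l = (j : ℕ) then 1 else 0) +
      (if l = (j : ℕ) + 1 then 1 else 0)) i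
    simp only [N] at this ⊢
    rw [this]
    simp only [tridiag]
    by_cases h1 : (i : ℕ) + 1 < n
    · simp only [h1, if_true, zero_mul, add_zero]
      split_ifs <;> first | omega | norm_num
    · by_cases h2 : (j : ℕ) + 1 < n
      · simp only [h1, h2, if_true, if_false, mul_zero, add_zero]
        split_ifs <;> first | omega | norm_num
      · have h3 : (i : ℕ) = j := by omega
        simp only [h2, h3, if_false, ← mul_pow]
        norm_num
  rw [hT, det_mul, det_mul, det_transpose, hN, det_one_add_replicateCol_mul_replicateRow]
  simp [u, dotProduct, ← mul_pow]
  ring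

theorem det_neg_two_mul_min (n : ℕ) :
    (Matrix.of fun i j : Fin n => (-2 : ℚ) * (min (i : ℕ) j + 1 : ℕ)).det = (-2) ^ n := by
  let L : Matrix (Fin n) (Fin n) ℚ := fun i j => if j ≤ i then 1 else 0
  have hL : L.det = 1 := by
    rw [det_of_isLowerTriangular]
    · simp [L]
    · intro i j hij
      exact if_neg (not_le.2 hij)
  have : (Matrix.of fun i j : Fin n => (-2 : ℚ) * (min (i : ℕ) j + 1 : ℕ)) =
      (-2 : ℚ) • (L * Lᵀ) := by
    ext i j
    rw [Matrix.smul_apply, mul_apply, of_apply, smul_eq_mul]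
    congr 1
    have : ∀ k, L i k * Lᵀ k j = if k ≤ min i j then 1 else 0 := by
      intro k
      rw [transpose_apply]
      simp only [L, le_min_iff, ite_and]
      split_ifs <;> simp
    simp only [this]
    rw [Finset.sum_boole]
    have h2 : (Finset.univ.filter fun k => k ≤ min i j) = Finset.Iic (min i j) := by
      ext; simp
    rw [h2, Fin.card_Iic]
    simp
  rw [this, det_smul, det_mul, det_transpose, hL]
  simp

/-- The distance between the vertices `0` and `k * m` of a cycle of odd length `p = 2 * m + 1`,
for `k ≤ p`. -/
def skipDist (p k : ℕ) : ℕ := if k % 2 = 0 then k / 2 else (p - k) / 2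

theorem skipDist_two_step {p : ℕ} (hp : p % 2 = 1) {k : ℕ} (hk : k + 2 ≤ p) :
    skipDist p k + 2 * skipDist p (k + 1) + skipDist p (k + 2) = p := by
  unfold skipDist
  rcases Nat.mod_two_eq_zero_or_one k with h | h
  · rw [if_pos h, if_neg (by omega), if_pos (by omega)]
    omega
  · rw [if_neg (by omega), if_pos (by omega), if_neg (by omega)]
    omega

theorem skipDist_sub_two_step {p : ℕ} (hp : p % 2 = 1) {k j : ℕ} (hk : k < p) (hj : j + 2 ≤ p) :
    skipDist p ((k - j) + (j - k)) + 2 * skipDist p ((k - (j + 1)) + ((j + 1) - k)) +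
      skipDist p ((k - (j + 2)) + ((j + 2) - k)) + (if k = j + 1 then 1 else 0) = p := by
  rcases lt_trichotomy k (j + 1) with h | h | h
  · have := skipDist_two_step hp (k := j - k) (by omega)
    rw [if_neg (by omega), show k - j + (j - k) = j - k by omega,
      show k - (j + 1) + (j + 1 - k) = j - k + 1 by omega,
      show k - (j + 2) + (j + 2 - k) = j - k + 2 by omega]
    omega
  · subst h
    rw [if_pos rfl, show j + 1 - j + (j - (j + 1)) = 1 by omega,
      show j + 1 - (j + 1) + (j + 1 - (j + 1)) = 0 by omega,
      show j + 1 - (j + 2) + (j + 2 - (j + 1)) = 1 by omega]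
    simp only [skipDist]
    norm_num
    omega
  · have := skipDist_two_step hp (k := k - (j + 2)) (by omega)
    rw [if_neg (by omega), show k - j + (j - k) = k - (j + 2) + 2 by omega,
      show k - (j + 1) + (j + 1 - k) = k - (j + 2) + 1 by omega,
      show k - (j + 2) + (j + 2 - k) = k - (j + 2) by omega]
    omega

theorem skipDist_sub {p : ℕ} (hp : p % 2 = 1) {k : ℕ} (hk : k ≤ p) :
    skipDist p (p - k) = skipDist p k := by
  unfold skipDist
  rcases Nat.mod_two_eq_zero_or_one k with h | h
  · rw [if_neg (by omega), if_pos (by omega)]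
    omega
  · rw [if_pos (by omega), if_neg (by omega)]

theorem skipDist_zero (p : ℕ) : skipDist p 0 = 0 := by simp [skipDist]

theorem skipDist_self {p : ℕ} (hp : p % 2 = 1) : skipDist p p = 0 := by
  simpa [skipDist_zero] using skipDist_sub hp (Nat.zero_le p)

theorem sum_skipDist (m : ℕ) : ∑ k ∈ Finset.range (2 * m + 1), skipDist (2 * m + 1) k =
    m * (m + 1) := by
  have : ∀ j ≤ m, ∑ k ∈ Finset.range (2 * j + 1), skipDist (2 * m + 1) k = j * (m + 1) := by
    intro j
    induction j with
    | zero => simp [skipDist_zero]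
    | succ j ih =>
      intro hj
      rw [show 2 * (j + 1) + 1 = 2 * j + 1 + 1 + 1 by ring, Finset.sum_range_succ,
        Finset.sum_range_succ, ih (by omega)]
      have h1 : skipDist (2 * m + 1) (2 * j + 1) = m - j := by
        unfold skipDist
        rw [if_neg (by omega)]
        omega
      have h2 : skipDist (2 * m + 1) (2 * j + 1 + 1) = j + 1 := by
        unfold skipDist
        rw [if_pos (by omega)]
        omega
      rw [h1, h2, add_one_mul]
      omega
  exact this m le_rfl

theorem sum_skipDist_sub (m k : ℕ) (hk : k ≤ 2 * m) :
    ∑ l ∈ Finset.range (2 * m + 1), skipDist (2 * m + 1) ((k - l) + (l - k)) = m * (m + 1) := by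
  induction k with
  | zero => simpa using sum_skipDist m
  | succ k ih =>
    rw [← ih (by omega), Finset.sum_range_succ', Finset.sum_range_succ]
    congr 1
    · refine Finset.sum_congr rfl fun l _ => ?_
      congr 1
      omega
    · rw [show k - 2 * m + (2 * m - k) = 2 * m + 1 - (k + 1) by omega,
        skipDist_sub (by omega) (by omega)]
      simp

/-- The distance matrix of an odd cycle, reduced at the vertex `0`. -/
def oddCycleReduced (m : ℕ) : Matrix (Fin (2 * m)) (Fin (2 * m)) ℚ := fun i j =>
  (skipDist (2 * m + 1) ((i - j : ℕ) + (j - i : ℕ)) : ℚ) - skipDist (2 * m + 1) (i + 1) -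
    skipDist (2 * m + 1) (j + 1)

theorem sum_skipDist_succ (m : ℕ) :
    ∑ i : Fin (2 * m), (skipDist (2 * m + 1) (i + 1) : ℚ) = m * (m + 1) := by
  rw [Fin.sum_univ_eq_sum_range (fun i => (skipDist (2 * m + 1) (i + 1) : ℚ))]
  have h := sum_skipDist m
  rw [Finset.sum_range_succ', skipDist_zero] at h
  exact_mod_cast h

theorem oddCycleReduced_mulVec (m : ℕ) :
    oddCycleReduced m *ᵥ (fun _ => -1 / ((2 * m + 1 : ℕ) : ℚ)) =
      fun i : Fin (2 * m) => (skipDist (2 * m + 1) (i + 1) : ℚ) := by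
  ext i
  have hi := i.2
  have h := sum_skipDist_sub m (i + 1) (by omega)
  rw [Finset.sum_range_succ'] at h
  simp only [Nat.add_sub_add_right, Nat.sub_zero, Nat.zero_sub, add_zero] at h
  rw [← Fin.sum_univ_eq_sum_range
    (fun l => skipDist (2 * m + 1) ((i - l : ℕ) + (l - i : ℕ)))] at h
  have h' : ∑ l : Fin (2 * m), (skipDist (2 * m + 1) ((i - l : ℕ) + (l - i : ℕ)) : ℚ) =
      m * (m + 1) - skipDist (2 * m + 1) (i + 1) := by
    rw [eq_sub_iff_add_eq]
    exact_mod_cast h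
  rw [mulVec, dotProduct, ← Finset.sum_mul]
  simp only [oddCycleReduced, Finset.sum_sub_distrib]
  rw [h', sum_skipDist_succ]
  have : (2 * (m : ℚ) + 1) ≠ 0 := by positivity
  simp
  field_simp
  ring

theorem oddCycleReduced_mul_tridiag (m : ℕ) :
    oddCycleReduced m * tridiag (2 * m) = -(1 + vecMulVec
      (fun i : Fin (2 * m) => 4 * (skipDist (2 * m + 1) (i + 1) : ℚ)) 1) := by
  ext i j
  have hi := i.2
  have hj := j.2
  have hp : (2 * m + 1) % 2 = 1 := by omega
  have h := sum_mul_tridiag (2 * m) (fun l =>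
    (skipDist (2 * m + 1) (((i + 1 : ℕ) - l) + (l - (i + 1 : ℕ))) : ℚ) -
      skipDist (2 * m + 1) (i + 1) - skipDist (2 * m + 1) l)
    (by simp [skipDist_zero])
    (by
      rw [skipDist_self hp, show (i + 1 : ℕ) - (2 * m + 1) + (2 * m + 1 - (i + 1)) =
        2 * m + 1 - (i + 1) by omega, skipDist_sub hp (by omega)]
      simp) j
  simp only [Nat.add_sub_add_right] at h
  have h1 := skipDist_two_step hp (k := j) (by omega)
  have h2 := skipDist_sub_two_step hp (k := i + 1) (j := j) (by omega) (by omega)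
  have h1 : (skipDist (2 * m + 1) j : ℚ) + 2 * skipDist (2 * m + 1) (j + 1) +
    skipDist (2 * m + 1) (j + 2) = 2 * m + 1 := by exact_mod_cast h1
  have h2 : (skipDist (2 * m + 1) ((i + 1 - j : ℕ) + (j - (i + 1) : ℕ)) : ℚ) +
      2 * skipDist (2 * m + 1) ((i - j : ℕ) + (j - i : ℕ)) +
      skipDist (2 * m + 1) ((i + 1 - (j + 2) : ℕ) + (j + 2 - (i + 1) : ℕ)) +
      (if i = j then 1 else 0) = 2 * m + 1 := by
    rw [Nat.add_sub_add_right, Nat.add_sub_add_right] at h2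
    simp only [Nat.add_right_cancel_iff, ← Fin.ext_iff] at h2
    exact_mod_cast h2
  rw [mul_apply]
  refine h.trans ?_
  rw [Matrix.neg_apply, Matrix.add_apply, one_apply]
  simp only [vecMulVec_apply, Pi.one_apply, mul_one, Nat.add_sub_add_right,
    show (j : ℕ) + 2 = j + 1 + 1 from rfl] at h1 h2 ⊢
  linarith

theorem det_oddCycleReduced (m : ℕ) : (oddCycleReduced m).det = (2 * m + 1 : ℕ) := by
  have h := congrArg det (oddCycleReduced_mul_tridiag m)
  rw [det_mul, det_tridiag, det_neg, vecMulVec_eq Unit, det_one_add_replicateCol_mul_replicateRow] at h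
  simp only [dotProduct, Pi.one_apply, one_mul, ← Finset.mul_sum, sum_skipDist_succ,
    Fintype.card_fin, even_two, Even.mul_right, Even.neg_pow, one_pow] at h
  have hne : (2 * (m : ℚ) + 1) ≠ 0 := by positivity
  push_cast at h ⊢
  apply mul_right_cancel₀ hne
  rw [h]
  ring

theorem det_eq_zero_of_col_add_eq {ι : Type*} [Fintype ι] [DecidableEq ι] (D : Matrix ι ι ℚ)
    {v₁ v₂ v₃ v₄ : ι} (h2 : v₁ ≠ v₂) (h3 : v₁ ≠ v₃) (h4 : v₁ ≠ v₄)
    (h : ∀ i, D i v₁ + D i v₂ = D i v₃ + D i v₄) : D.det = 0 := by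
  rw [← exists_mulVec_eq_zero_iff]
  refine ⟨Pi.single v₁ 1 + Pi.single v₂ 1 - (Pi.single v₃ 1 + Pi.single v₄ 1), ?_, ?_⟩
  · intro h0
    have := congrFun h0 v₁
    simp [h2, h3, h4] at this
  · ext i
    simp only [mulVec_sub, mulVec_add, mulVec_single_one, Pi.sub_apply, Pi.add_apply, col_apply,
      Pi.zero_apply, h i, sub_self]

theorem cycleDist_add_antipode {m x j : ℕ} (hx : x < m + m) (hj : j < m) :
    cycleDist (m + m) x j + cycleDist (m + m) x (j + m) = m := by
  unfold cycleDist
  omega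

theorem det_distMatrix_Gpq_of_even_left {p q n : ℕ} (hp : 3 ≤ p) (hq : 3 ≤ q) (h : Even p) :
    (distMatrix (Gpq p q n)).det = 0 := by
  obtain ⟨m, rfl⟩ := h
  have key : ∀ v, v < m + m → coordP (m + m) v = v ∧ coordQ (m + m) q v = 0 ∧
      coordN (m + m) q v = 0 := by
    intro v hv
    have := coord_cases hp hq v
    omega
  refine det_eq_zero_of_col_add_eq _ (v₁ := ⟨0, by omega⟩) (v₂ := ⟨0 + m, by omega⟩)
    (v₃ := ⟨1, by omega⟩) (v₄ := ⟨1 + m, by omega⟩) ?_ ?_ ?_ fun i => ?_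
  · rw [ne_eq, Fin.mk.injEq]; omega
  · rw [ne_eq, Fin.mk.injEq]; omega
  · rw [ne_eq, Fin.mk.injEq]; omega
  · simp only [distMatrix_Gpq hp hq]
    norm_cast
    have hi := coordP_lt hp hq i
    have h0 := cycleDist_add_antipode hi (j := 0) (by omega)
    have h1 := cycleDist_add_antipode hi (j := 1) (by omega)
    obtain ⟨a1, a2, a3⟩ := key 0 (by omega)
    obtain ⟨b1, b2, b3⟩ := key (0 + m) (by omega)
    obtain ⟨c1, c2, c3⟩ := key 1 (by omega)
    obtain ⟨d1, d2, d3⟩ := key (1 + m) (by omega)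
    unfold gpqDist
    rw [a1, a2, a3, b1, b2, b3, c1, c2, c3, d1, d2, d3]
    omega

theorem det_distMatrix_Gpq_of_even_right {p q n : ℕ} (hp : 3 ≤ p) (hq : 3 ≤ q) (h : Even q) :
    (distMatrix (Gpq p q n)).det = 0 := by
  obtain ⟨m, rfl⟩ := h
  have key : ∀ v c, v < m + m → (c = 0 ∧ v = 0 ∨ p ≤ c ∧ c = v + (p - 1)) →
      coordP p c = 0 ∧ coordQ p (m + m) c = v ∧ coordN p (m + m) c = 0 := by
    intro v c hv hc
    have := coord_cases hp hq c
    omega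
  refine det_eq_zero_of_col_add_eq _ (v₁ := ⟨0, by omega⟩) (v₂ := ⟨0 + m + (p - 1), by omega⟩)
    (v₃ := ⟨1 + (p - 1), by omega⟩) (v₄ := ⟨1 + m + (p - 1), by omega⟩) ?_ ?_ ?_ fun i => ?_
  · rw [ne_eq, Fin.mk.injEq]; omega
  · rw [ne_eq, Fin.mk.injEq]; omega
  · rw [ne_eq, Fin.mk.injEq]; omega
  · simp only [distMatrix_Gpq hp hq]
    norm_cast
    have hi := coordQ_lt hp hq i
    have h0 := cycleDist_add_antipode hi (j := 0) (by omega)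
    have h1 := cycleDist_add_antipode hi (j := 1) (by omega)
    obtain ⟨a1, a2, a3⟩ := key 0 0 (by omega) (by omega)
    obtain ⟨b1, b2, b3⟩ := key (0 + m) (0 + m + (p - 1)) (by omega) (by omega)
    obtain ⟨c1, c2, c3⟩ := key 1 (1 + (p - 1)) (by omega) (by omega)
    obtain ⟨d1, d2, d3⟩ := key (1 + m) (1 + m + (p - 1)) (by omega) (by omega)
    unfold gpqDist
    rw [a1, a2, a3, b1, b2, b3, c1, c2, c3, d1, d2, d3]
    omega

/-- The vertex `k * m` of a cycle of odd length `p = 2 * m + 1`, for `0 < k < p`. -/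
def skipPos (p k : ℕ) : ℕ := if k % 2 = 0 then p - k / 2 else (p - k) / 2

theorem skipPos_mem {p k : ℕ} (hp : p % 2 = 1) (hk : k + 1 < p) :
    0 < skipPos p (k + 1) ∧ skipPos p (k + 1) < p := by
  unfold skipPos
  split_ifs <;> omega

theorem cycleDist_zero_skipPos {p k : ℕ} (hp : p % 2 = 1) (hk : k + 1 < p) :
    cycleDist p 0 (skipPos p (k + 1)) = skipDist p (k + 1) := by
  unfold skipPos skipDist cycleDist
  split_ifs <;> omega

theorem cycleDist_skipPos_zero {p k : ℕ} (hp : p % 2 = 1) (hk : k + 1 < p) :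
    cycleDist p (skipPos p (k + 1)) 0 = skipDist p (k + 1) := by
  unfold skipPos skipDist cycleDist
  split_ifs <;> omega

theorem cycleDist_skipPos {p k l : ℕ} (hp : p % 2 = 1) (hk : k + 1 < p) (hl : l + 1 < p) :
    cycleDist p (skipPos p (k + 1)) (skipPos p (l + 1)) = skipDist p ((k - l) + (l - k)) := by
  unfold skipPos skipDist cycleDist
  split_ifs <;> omega

theorem skipPos_inj {p k l : ℕ} (hp : p % 2 = 1) (hk : k + 1 < p) (hl : l + 1 < p)
    (h : skipPos p (k + 1) = skipPos p (l + 1)) : k = l := by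
  unfold skipPos at h
  split_ifs at h <;> omega

/-- The vertices of `G(p,q;n)` for odd `p` and `q`, split into the center vertex, the two cycles
(in the order given by `skipPos`) and the pendant path. -/
def gpqVertex (a b n : ℕ) : Unit ⊕ (Fin (2 * a) ⊕ (Fin (2 * b) ⊕ Fin n)) → ℕ
  | .inl _ => 0
  | .inr (.inl i) => skipPos (2 * a + 1) (i + 1)
  | .inr (.inr (.inl i)) => skipPos (2 * b + 1) (i + 1) + 2 * a
  | .inr (.inr (.inr i)) => i + 1 + (2 * a + 2 * b)

theorem gpqVertex_coord {a b : ℕ} (ha : 1 ≤ a) (hb : 1 ≤ b) (n : ℕ)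
    (v : Unit ⊕ (Fin (2 * a) ⊕ (Fin (2 * b) ⊕ Fin n))) :
    gpqVertex a b n v < 2 * a + 1 + (2 * b + 1) - 1 + n ∧
    coordP (2 * a + 1) (gpqVertex a b n v) = Sum.elim (fun _ => 0)
      (Sum.elim (fun i : Fin (2 * a) => skipPos (2 * a + 1) (i + 1)) (fun _ => 0)) v ∧
    coordQ (2 * a + 1) (2 * b + 1) (gpqVertex a b n v) = Sum.elim (fun _ => 0)
      (Sum.elim (fun _ => 0) (Sum.elim
        (fun i : Fin (2 * b) => skipPos (2 * b + 1) (i + 1)) (fun _ => 0))) v ∧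
    coordN (2 * a + 1) (2 * b + 1) (gpqVertex a b n v) = Sum.elim (fun _ => 0)
      (Sum.elim (fun _ => 0) (Sum.elim (fun _ => 0) (fun i : Fin n => (i : ℕ) + 1))) v := by
  have h := coord_cases (p := 2 * a + 1) (q := 2 * b + 1) (by omega) (by omega)
    (gpqVertex a b n v)
  rcases v with v | i | i | i
  · simp only [gpqVertex, Sum.elim_inl] at h ⊢
    omega
  · have := skipPos_mem (p := 2 * a + 1) (k := i) (by omega) (by omega)
    simp only [gpqVertex, Sum.elim_inl, Sum.elim_inr] at h ⊢
    omega
  · have := skipPos_mem (p := 2 * b + 1) (k := i) (by omega) (by omega)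
    simp only [gpqVertex, Sum.elim_inl, Sum.elim_inr] at h ⊢
    omega
  · simp only [gpqVertex, Sum.elim_inr] at h ⊢
    omega

theorem gpqVertex_injective (a b n : ℕ) : Function.Injective (gpqVertex a b n) := by
  rintro (v | i | i | i) (w | j | j | j) h
  all_goals simp only [gpqVertex] at h
  · rfl
  · have := skipPos_mem (p := 2 * a + 1) (k := j) (by omega) (by omega)
    omega
  · have := skipPos_mem (p := 2 * b + 1) (k := j) (by omega) (by omega)
    omega
  · omega
  · have := skipPos_mem (p := 2 * a + 1) (k := i) (by omega) (by omega)
    omega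
  · obtain rfl := Fin.ext (skipPos_inj (by omega) (by omega) (by omega) h)
    rfl
  · have := skipPos_mem (p := 2 * a + 1) (k := i) (by omega) (by omega)
    have := skipPos_mem (p := 2 * b + 1) (k := j) (by omega) (by omega)
    omega
  · have := skipPos_mem (p := 2 * a + 1) (k := i) (by omega) (by omega)
    omega
  · have := skipPos_mem (p := 2 * b + 1) (k := i) (by omega) (by omega)
    omega
  · have := skipPos_mem (p := 2 * a + 1) (k := j) (by omega) (by omega)
    have := skipPos_mem (p := 2 * b + 1) (k := i) (by omega) (by omega)
    omega
  · obtain rfl := Fin.ext (skipPos_inj (p := 2 * b + 1) (by omega) (by omega) (by omega)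
      (Nat.add_right_cancel h))
    rfl
  · have := skipPos_mem (p := 2 * b + 1) (k := i) (by omega) (by omega)
    omega
  · omega
  · have := skipPos_mem (p := 2 * a + 1) (k := j) (by omega) (by omega)
    omega
  · have := skipPos_mem (p := 2 * b + 1) (k := j) (by omega) (by omega)
    omega
  · obtain rfl : i = j := Fin.ext (by omega)
    rfl

/-- The distance matrix of a path, reduced at an end vertex. -/
def pathReduced (n : ℕ) : Matrix (Fin n) (Fin n) ℚ :=
  Matrix.of fun i j => (-2 : ℚ) * (min (i : ℕ) j + 1 : ℕ)

theorem pathReduced_mulVec (n : ℕ) :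
    pathReduced n *ᵥ (fun i : Fin n => if (i : ℕ) + 1 = n then -1 / 2 else 0) =
      fun i : Fin n => ((i : ℕ) : ℚ) + 1 := by
  cases n with
  | zero => exact Subsingleton.elim _ _
  | succ n =>
    ext i
    rw [mulVec, dotProduct, Fin.sum_univ_castSucc, Finset.sum_eq_zero]
    · have : ((i : ℕ) : ℚ) ≤ n := by exact_mod_cast Fin.is_le i
      simp [pathReduced, min_eq_left this]
      ring
    · intro j _
      have := j.2
      simp [this.ne]

theorem path_dotProduct (n : ℕ) : (fun i : Fin n => ((i : ℕ) : ℚ) + 1) ⬝ᵥ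
    (fun i : Fin n => if (i : ℕ) + 1 = n then -1 / 2 else 0) = -(n / 2 : ℚ) := by
  cases n with
  | zero => simp
  | succ n =>
    rw [dotProduct, Fin.sum_univ_castSucc, Finset.sum_eq_zero]
    · simp
      ring
    · intro j _
      have := j.2
      simp [this.ne]

theorem det_distMatrix_Gpq_of_odd {a b : ℕ} (ha : 1 ≤ a) (hb : 1 ≤ b) (n : ℕ) :
    (distMatrix (Gpq (2 * a + 1) (2 * b + 1) n)).det =
      (a * (a + 1) * (2 * b + 1) + b * (b + 1) * (2 * a + 1) +
        n / 2 * ((2 * a + 1) * (2 * b + 1))) * (-2 : ℚ) ^ n := by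
  have hcoord := gpqVertex_coord ha hb n
  let f : Unit ⊕ (Fin (2 * a) ⊕ (Fin (2 * b) ⊕ Fin n)) →
      Fin (2 * a + 1 + (2 * b + 1) - 1 + n) := fun v => ⟨gpqVertex a b n v, (hcoord v).1⟩
  have hf : Function.Bijective f := by
    rw [Fintype.bijective_iff_injective_and_card]
    refine ⟨fun v w h => gpqVertex_injective a b n (Fin.mk.inj_iff.1 h), ?_⟩
    simp only [Fintype.card_sum, Fintype.card_fin, Fintype.card_unit]
    omega
  let e := Equiv.ofBijective f hf
  have hD : ∀ v w, (distMatrix (Gpq (2 * a + 1) (2 * b + 1) n)).submatrix e e v w =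
      gpqDist (2 * a + 1) (2 * b + 1) (gpqVertex a b n v) (gpqVertex a b n w) :=
    fun v w => distMatrix_Gpq (by omega) (by omega) _ _
  have hdist : ∀ v w, gpqDist (2 * a + 1) (2 * b + 1) (gpqVertex a b n v) (gpqVertex a b n w) = _ :=
    fun v w => by
      rw [gpqDist, (hcoord v).2.1, (hcoord v).2.2.1, (hcoord v).2.2.2, (hcoord w).2.1,
        (hcoord w).2.2.1, (hcoord w).2.2.2]
  have h0 : ∀ p, cycleDist p 0 0 = 0 := fun p => by simp [cycleDist]
  have hpa : (2 * a + 1) % 2 = 1 := by omega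
  have hpb : (2 * b + 1) % 2 = 1 := by omega
  have hia : ∀ i : Fin (2 * a), (i : ℕ) + 1 < 2 * a + 1 := fun i => by omega
  have hib : ∀ i : Fin (2 * b), (i : ℕ) + 1 < 2 * b + 1 := fun i => by omega
  rw [← det_submatrix_equiv_self e, det_of_cone _
    (fromBlocks (oddCycleReduced a) 0 0 (fromBlocks (oddCycleReduced b) 0 0 (pathReduced n)))
    (Sum.elim (fun i => (skipDist (2 * a + 1) (i + 1) : ℚ))
      (Sum.elim (fun i => (skipDist (2 * b + 1) (i + 1) : ℚ)) (fun i => ((i : ℕ) : ℚ) + 1)))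
    (Sum.elim (fun _ => -1 / ((2 * a + 1 : ℕ) : ℚ))
      (Sum.elim (fun _ => -1 / ((2 * b + 1 : ℕ) : ℚ))
        (fun i : Fin n => if (i : ℕ) + 1 = n then -1 / 2 else 0)))]
  · rw [det_fromBlocks_zero₁₂, det_fromBlocks_zero₁₂, det_oddCycleReduced, det_oddCycleReduced,
      pathReduced, det_neg_two_mul_min, sumElim_dotProduct_sumElim, sumElim_dotProduct_sumElim,
      path_dotProduct]
    simp only [dotProduct, ← Finset.sum_mul, sum_skipDist_succ]
    have h1 : (2 * (a : ℚ) + 1) ≠ 0 := by positivity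
    have h2 : (2 * (b : ℚ) + 1) ≠ 0 := by positivity
    push_cast
    field_simp
    ring
  · rw [hD, hdist]
    simp [h0]
  · rintro (i | i | i)
    · rw [hD, hdist]
      simp [h0, cycleDist_zero_skipPos hpa (hia i)]
    · rw [hD, hdist]
      simp [h0, cycleDist_zero_skipPos hpb (hib i)]
    · rw [hD, hdist]
      simp [h0]
  · rintro (i | i | i)
    · rw [hD, hdist]
      simp [h0, cycleDist_skipPos_zero hpa (hia i)]
    · rw [hD, hdist]
      simp [h0, cycleDist_skipPos_zero hpb (hib i)]
    · rw [hD, hdist]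
      simp [h0]
  · rintro (i | i | i) (j | j | j)
    all_goals rw [hD, hdist]
    · simp [h0, cycleDist_skipPos hpa (hia i) (hia j), oddCycleReduced]
      ring
    · simp [cycleDist_skipPos_zero hpa (hia i), cycleDist_zero_skipPos hpb (hib j)]
    · simp [h0, cycleDist_skipPos_zero hpa (hia i)]
    · simp [cycleDist_skipPos_zero hpb (hib i), cycleDist_zero_skipPos hpa (hia j)]
      ring
    · simp [h0, cycleDist_skipPos hpb (hib i) (hib j), oddCycleReduced]
      ring
    · simp [h0, cycleDist_skipPos_zero hpb (hib i)]
    · simp [h0, cycleDist_zero_skipPos hpa (hia j)]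
      ring
    · simp [h0, cycleDist_zero_skipPos hpb (hib j)]
      ring
    · simp only [Sum.elim_inr, h0, fromBlocks_apply₂₂, pathReduced, of_apply]
      rcases le_total (i : ℕ) j with h | h
      · rw [min_eq_left h]
        obtain ⟨k, hk⟩ := Nat.exists_eq_add_of_le h
        rw [hk, show 0 + 0 + ((i : ℕ) + 1 - (i + k + 1) + (i + k + 1 - (i + 1))) = k by omega]
        push_cast
        ring
      · rw [min_eq_right h]
        obtain ⟨k, hk⟩ := Nat.exists_eq_add_of_le h
        rw [hk, show 0 + 0 + ((j : ℕ) + k + 1 - (j + 1) + (j + 1 - (j + k + 1))) = k by omega]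
        push_cast
        ring
  · rw [fromBlocks_mulVec, fromBlocks_mulVec]
    simp only [Sum.elim_comp_inl, Sum.elim_comp_inr, zero_mulVec, add_zero, zero_add,
      oddCycleReduced_mulVec, pathReduced_mulVec]

/-- For `p, q ≥ 3` and `n ≥ 0`, the determinant of the distance matrix of
`G(p,q;n)` is `0` when `p` or `q` is even, and equals
`((pq-1)(p+q)/4 + (n/2)pq)·(-2)^n` when both `p` and `q` are odd. -/
theorem det_distMatrix_Gpq (p q n : ℕ) (hp : 3 ≤ p) (hq : 3 ≤ q) :
    ((Even p ∨ Even q) → (distMatrix (Gpq p q n)).det = 0) ∧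
    ((Odd p ∧ Odd q) → (distMatrix (Gpq p q n)).det =
      (((p : ℚ) * q - 1) * ((p : ℚ) + q) / 4 + (n : ℚ) / 2 * ((p : ℚ) * q)) *
        (-2 : ℚ) ^ n) := by
  refine ⟨?_, ?_⟩
  · rintro (h | h)
    · exact det_distMatrix_Gpq_of_even_left hp hq h
    · exact det_distMatrix_Gpq_of_even_right hp hq h
  · rintro ⟨⟨a, rfl⟩, ⟨b, rfl⟩⟩
    rw [det_distMatrix_Gpq_of_odd (by omega) (by omega)]
    push_cast
    ring
end

section
/- Let p, q ≥ 3 and k ≥ 1 be integers. Then the determinant of the distance matrix of the ∞-graph ∞(p,k,q) equals the determinant of the distance matrix of G(p,q;k−1). -/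
open SimpleGraph Matrix

/-- The ∞-graph `∞(p,k,q)` on `Fin (p+q+k-2)`: the cycle `C_p` on the vertices
`0, …, p-1`, the path `v₁ = 0, v₂ = p, …, v_k = p+k-2` of length `k-1`
(for `k = 1` the path is the single vertex `v₁ = 0`), and the cycle `C_q` on the
vertices `v_k, p+k-1, …, p+q+k-3`. -/
def inftyGraph (p k q : ℕ) : SimpleGraph (Fin (p + q + k - 2)) :=
  SimpleGraph.fromRel (fun a b =>
    ((a : ℕ) + 1 = (b : ℕ) ∧ (b : ℕ) < p) ∨
    ((a : ℕ) = 0 ∧ (b : ℕ) = p - 1) ∨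
    (2 ≤ k ∧ (a : ℕ) = 0 ∧ (b : ℕ) = p) ∨
    (p ≤ (a : ℕ) ∧ (a : ℕ) + 1 = (b : ℕ) ∧ (b : ℕ) ≤ p + k - 2) ∨
    ((a : ℕ) = (if k = 1 then 0 else p + k - 2) ∧ (b : ℕ) = p + k - 1) ∨
    ((a : ℕ) = (if k = 1 then 0 else p + k - 2) ∧ (b : ℕ) = p + q + k - 3) ∨
    (p + k - 1 ≤ (a : ℕ) ∧ (a : ℕ) + 1 = (b : ℕ) ∧ (b : ℕ) ≤ p + q + k - 3))

/-- Two graphs glued along a vertex: the vertex `0` of `H` is identified with the vertex `v`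
of `R`.  It is realised inside the box product `H □ R`. -/
def glue {m : ℕ} {β : Type*} (H : SimpleGraph (Fin (m + 1))) (R : SimpleGraph β) (v : β) :
    SimpleGraph (Fin m ⊕ β) :=
  (H □ R).comap (Sum.elim (fun a => (a.succ, v)) (fun b => (0, b)))

section Glue

variable {m : ℕ} {β : Type*} {H : SimpleGraph (Fin (m + 1))} {R : SimpleGraph β}

/-- The inclusion of `R` into `glue H R v`. -/
def glueInr (H : SimpleGraph (Fin (m + 1))) (R : SimpleGraph β) (v : β) : R →g glue H R v where
  toFun := Sum.inr
  map_rel' h := by simpa [glue, boxProd_adj] using h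

/-- The inclusion of `H` into `glue H R v`. -/
def glueInl (H : SimpleGraph (Fin (m + 1))) (R : SimpleGraph β) (v : β) : H →g glue H R v where
  toFun := Fin.cases (Sum.inr v) Sum.inl
  map_rel' {a b} h := by
    cases a using Fin.cases <;> cases b using Fin.cases <;> simp_all [glue, boxProd_adj]

/-- The inclusion of `glue H R v` into the box product. -/
def glueToBoxProd (H : SimpleGraph (Fin (m + 1))) (R : SimpleGraph β) (v : β) :
    glue H R v →g H □ R where
  toFun := Sum.elim (fun a => (a.succ, v)) (fun b => (0, b))
  map_rel' h := h

@[simp]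
lemma glueToBoxProd_inl (v : β) (a : Fin m) :
    glueToBoxProd H R v (Sum.inl a) = (a.succ, v) := rfl

@[simp]
lemma glueToBoxProd_inr (v b : β) : glueToBoxProd H R v (Sum.inr b) = (0, b) := rfl

lemma dist_map_le {V W : Type*} {G : SimpleGraph V} {G' : SimpleGraph W} (hG : G.Connected)
    (f : G →g G') (a b : V) : G'.dist (f a) (f b) ≤ G.dist a b := by
  obtain ⟨w, hw⟩ := hG.exists_walk_length_eq_dist a b
  rw [← hw, ← Walk.length_map f w]
  exact dist_le _

lemma dist_iso {V W : Type*} {G : SimpleGraph V} {G' : SimpleGraph W} (hG : G.Connected)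
    (e : G ≃g G') (a b : V) : G'.dist (e a) (e b) = G.dist a b :=
  le_antisymm (dist_map_le hG e.toHom a b) <| by
    simpa using dist_map_le (e.connected_iff.1 hG) e.symm.toHom (e a) (e b)

lemma dist_boxProd_of_connected {V W : Type*} {G : SimpleGraph V} {G' : SimpleGraph W}
    (hG : G.Connected) (hG' : G'.Connected) (x y : V × W) :
    (G □ G').dist x y = G.dist x.1 y.1 + G'.dist x.2 y.2 := by
  rw [SimpleGraph.dist, edist_boxProd, ENat.toNat_add
    (edist_ne_top_iff_reachable.2 (hG _ _)) (edist_ne_top_iff_reachable.2 (hG' _ _))]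
  rfl

lemma glue_connected (hH : H.Connected) (hR : R.Connected) (v : β) :
    (glue H R v).Connected := by
  have key : ∀ x, (glue H R v).Reachable (Sum.inr v) x := by
    rintro (a | b)
    · simpa [glueInl] using (hH 0 a.succ).map (glueInl H R v)
    · simpa [glueInr] using (hR v b).map (glueInr H R v)
  exact { preconnected := fun x y => (key x).symm.trans (key y), nonempty := ⟨Sum.inr v⟩ }

lemma dist_glue_inr_inr (hH : H.Connected) (hR : R.Connected) (v b c : β) :
    (glue H R v).dist (Sum.inr b) (Sum.inr c) = R.dist b c :=
  le_antisymm (dist_map_le hR (glueInr H R v) b c) <| by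
    simpa [dist_boxProd_of_connected hH hR] using
      dist_map_le (glue_connected hH hR v) (glueToBoxProd H R v) (Sum.inr b) (Sum.inr c)

lemma dist_glue_inl_inl (hH : H.Connected) (hR : R.Connected) (v : β) (a c : Fin m) :
    (glue H R v).dist (Sum.inl a) (Sum.inl c) = H.dist a.succ c.succ :=
  le_antisymm (by simpa [glueInl] using dist_map_le hH (glueInl H R v) a.succ c.succ) <| by
    simpa [dist_boxProd_of_connected hH hR] using
      dist_map_le (glue_connected hH hR v) (glueToBoxProd H R v) (Sum.inl a) (Sum.inl c)

lemma dist_glue_inl_inr (hH : H.Connected) (hR : R.Connected) (v : β) (a : Fin m) (b : β) :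
    (glue H R v).dist (Sum.inl a) (Sum.inr b) = H.dist a.succ 0 + R.dist v b := by
  refine le_antisymm (((glue_connected hH hR v).dist_triangle (v := Sum.inr v)).trans ?_) ?_
  · exact add_le_add (by simpa [glueInl] using dist_map_le hH (glueInl H R v) a.succ 0)
      (dist_map_le hR (glueInr H R v) v b)
  · simpa [dist_boxProd_of_connected hH hR] using
      dist_map_le (glue_connected hH hR v) (glueToBoxProd H R v) (Sum.inl a) (Sum.inr b)

end Glue

/-- Subtracting the row and the column of the gluing vertex `v` from those of the first block
produces a matrix in which `v` no longer appears. -/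
lemma det_fromBlocks_add_row {α β K : Type*} [Fintype α] [DecidableEq α] [Fintype β]
    [DecidableEq β] [CommRing K] (A : Matrix α α K) (a : α → K) (R : Matrix β β K)
    (hR : R.IsSymm) (v : β) (hv : R v v = 0) :
    (fromBlocks A (of fun i j => a i + R v j) (of fun i j => a j + R v i) R).det =
      (fromBlocks (of fun i j => A i j - a i - a j) (of fun i _ => a i)
        (of fun _ j => a j) R).det := by
  set E : Matrix α β K := of fun _ j => if j = v then -1 else 0 with hE
  have hP : (fromBlocks 1 E 0 1 : Matrix (α ⊕ β) (α ⊕ β) K).det = 1 := by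
    simp
  have hQ : (fromBlocks 1 0 Eᵀ 1 : Matrix (α ⊕ β) (α ⊕ β) K).det = 1 := by
    simp
  have hsymm : ∀ i j, R i j = R j i := fun i j => hR.apply j i
  rw [← mul_one (det (fromBlocks A _ _ R)), ← hQ, ← one_mul (det (fromBlocks A _ _ R)), ← hP,
    ← det_mul, ← det_mul, fromBlocks_multiply, fromBlocks_multiply]
  congr 2 <;> ext i j <;> simp [Matrix.mul_apply, hE, hv, hsymm _ v]
  ring

/-- Moving the gluing point does not change the determinant of the distance matrix. -/
theorem det_distMatrix_glue {m : ℕ} {β : Type*} [Fintype β] [DecidableEq β]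
    {H : SimpleGraph (Fin (m + 1))} {R : SimpleGraph β} (hH : H.Connected) (hR : R.Connected)
    (v w : β) : (distMatrix (glue H R v)).det = (distMatrix (glue H R w)).det := by
  have key : ∀ v, distMatrix (glue H R v) =
      fromBlocks (of fun i j => (H.dist i.succ j.succ : ℚ))
        (of fun i j => (H.dist i.succ 0 : ℚ) + (R.dist v j : ℚ))
        (of fun i j => (H.dist j.succ 0 : ℚ) + (R.dist v i : ℚ)) (distMatrix R) := by
    intro v
    ext (i | i) (j | j)
    · simp [distMatrix, dist_glue_inl_inl hH hR]
    · simp [distMatrix, dist_glue_inl_inr hH hR]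
    · simp [distMatrix, dist_comm (u := Sum.inr i), dist_glue_inl_inr hH hR]
    · simp [distMatrix, dist_glue_inr_inr hH hR]
  have hsymm : (distMatrix R).IsSymm := by
    ext i j
    simp [distMatrix, dist_comm]
  have hdiag : ∀ v, distMatrix R v v = 0 := fun v => by simp [distMatrix]
  have hmove := fun v => det_fromBlocks_add_row (of fun i j : Fin m => (H.dist i.succ j.succ : ℚ))
    (fun i => (H.dist i.succ 0 : ℚ)) (distMatrix R) hsymm v (hdiag v)
  rw [key v, key w]
  exact (hmove v).trans (hmove w).symm

lemma det_distMatrix_of_iso {V W : Type*} [Fintype V] [DecidableEq V] [Fintype W] [DecidableEq W]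
    {G : SimpleGraph V} {G' : SimpleGraph W} (hG : G.Connected) (e : G ≃g G') :
    (distMatrix G').det = (distMatrix G).det := by
  rw [← det_submatrix_equiv_self e.toEquiv]
  congr 1
  ext i j
  simp [distMatrix, dist_iso hG e]

/-- A graph on `Fin n` is connected if every nonzero vertex has a smaller neighbour. -/
lemma connected_of_exists_lt_adj {n : ℕ} (hn : 0 < n) {G : SimpleGraph (Fin n)}
    (h : ∀ b : Fin n, 0 < (b : ℕ) → ∃ a : Fin n, a < b ∧ G.Adj a b) : G.Connected := by
  have key : ∀ b : Fin n, G.Reachable ⟨0, hn⟩ b := by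
    intro b
    induction b using WellFoundedLT.induction with
    | ind b ih =>
      rcases Nat.eq_zero_or_pos (b : ℕ) with hb | hb
      · rw [show b = ⟨0, hn⟩ from Fin.ext hb]
      · obtain ⟨a, hab, hadj⟩ := h b hb
        exact (ih a hab).trans hadj.reachable
  exact { preconnected := fun x y => (key x).symm.trans (key y), nonempty := ⟨⟨0, hn⟩⟩ }

/-- The cycle `0, 1, …, m`. -/
def cyc (m : ℕ) : SimpleGraph (Fin (m + 1)) :=
  SimpleGraph.fromRel fun a b => (a : ℕ) + 1 = b ∨ ((a : ℕ) = 0 ∧ (b : ℕ) = m)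

/-- The cycle `0, …, p-1` with a pendant path `0, p, …, p+n-1`. -/
def lollipop (p n : ℕ) : SimpleGraph (Fin (p + n)) :=
  SimpleGraph.fromRel fun a b =>
    ((a : ℕ) + 1 = b ∧ (b : ℕ) < p) ∨ ((a : ℕ) = 0 ∧ (b : ℕ) = p - 1) ∨
    ((a : ℕ) = 0 ∧ (b : ℕ) = p) ∨ (p ≤ (a : ℕ) ∧ (a : ℕ) + 1 = b)

lemma cyc_connected (m : ℕ) : (cyc m).Connected := by
  refine connected_of_exists_lt_adj m.succ_pos fun b hb => ⟨⟨b - 1, by omega⟩, ?_, ?_⟩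
  · rw [Fin.lt_def]
    dsimp only
    omega
  · simp only [cyc, fromRel_adj, ne_eq, Fin.ext_iff]
    omega

lemma lollipop_connected (p n : ℕ) (hp : 3 ≤ p) : (lollipop p n).Connected := by
  refine connected_of_exists_lt_adj (by omega) fun b hb =>
    ⟨⟨if (b : ℕ) = p then 0 else b - 1, by split_ifs <;> omega⟩, ?_, ?_⟩
  · rw [Fin.lt_def]
    dsimp only
    split_ifs <;> omega
  · simp only [lollipop, fromRel_adj, ne_eq, Fin.ext_iff]
    split_ifs <;> omega

/-- An adjacency-preserving injection between vertex sets of the same size is an isomorphism. -/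
noncomputable def isoOfInjective {V W : Type*} [Fintype V] [Fintype W] {G : SimpleGraph V}
    {G' : SimpleGraph W} (hcard : Fintype.card V = Fintype.card W) (f : V → W)
    (hf : Function.Injective f) (hadj : ∀ a b, G'.Adj (f a) (f b) ↔ G.Adj a b) : G ≃g G' where
  toEquiv := Equiv.ofBijective f ((Fintype.bijective_iff_injective_and_card f).2 ⟨hf, hcard⟩)
  map_rel_iff' := hadj _ _

/-- `∞(p,k,q)` is the cycle `C_q` glued to the end of the path of a lollipop. -/
noncomputable def inftyGraphIso (p m n : ℕ) (hp : 3 ≤ p) (hm : 2 ≤ m) :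
    glue (cyc m) (lollipop p n) ⟨if n = 0 then 0 else p + n - 1, by split_ifs <;> omega⟩ ≃g
      inftyGraph p (n + 1) (m + 1) :=
  isoOfInjective (by simp only [Fintype.card_sum, Fintype.card_fin]; omega)
    (Sum.elim (fun a => ⟨p + n + a, by omega⟩) (fun b => ⟨b, by omega⟩))
    (by
      rintro (a | a) (b | b) h <;>
        simp only [Sum.elim_inl, Sum.elim_inr, Sum.inl.injEq, Sum.inr.injEq, Fin.ext_iff,
          reduceCtorEq] at h ⊢ <;> omega)
    (by
      rintro (⟨a, ha⟩ | ⟨a, ha⟩) (⟨b, hb⟩ | ⟨b, hb⟩) <;>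
        simp only [glue, comap_adj, boxProd_adj, cyc, lollipop, inftyGraph, fromRel_adj, ne_eq,
          Fin.ext_iff, Sum.elim_inl, Sum.elim_inr, Fin.val_succ, Fin.val_zero] <;>
        grind (splits := 40))

/-- `G(p,q;n)` is the cycle `C_q` glued to the centre of a lollipop. -/
noncomputable def GpqIso (p m n : ℕ) (hp : 3 ≤ p) (hm : 2 ≤ m) :
    glue (cyc m) (lollipop p n) ⟨0, by omega⟩ ≃g Gpq p (m + 1) n :=
  isoOfInjective (by simp only [Fintype.card_sum, Fintype.card_fin]; omega)
    (Sum.elim (fun a => ⟨p + a, by omega⟩)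
      (fun b => ⟨if (b : ℕ) < p then b else b + m, by split_ifs <;> omega⟩))
    (by
      rintro (a | a) (b | b) h <;>
        simp only [Sum.elim_inl, Sum.elim_inr, Sum.inl.injEq, Sum.inr.injEq, Fin.ext_iff,
          reduceCtorEq] at h ⊢ <;> (try split_ifs at h) <;> omega)
    (by
      rintro (⟨a, ha⟩ | ⟨a, ha⟩) (⟨b, hb⟩ | ⟨b, hb⟩) <;>
        simp only [glue, comap_adj, boxProd_adj, cyc, lollipop, Gpq, fromRel_adj, ne_eq,
          Fin.ext_iff, Sum.elim_inl, Sum.elim_inr, Fin.val_succ, Fin.val_zero] <;>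
        grind (splits := 40))

/-- For `p, q ≥ 3` and `k ≥ 1`, the distance matrices of the ∞-graph `∞(p,k,q)`
and of `G(p,q;k-1)` have the same determinant. -/
theorem det_distMatrix_infty_eq (p q k : ℕ) (hp : 3 ≤ p) (hq : 3 ≤ q) (hk : 1 ≤ k) :
    (distMatrix (inftyGraph p k q)).det = (distMatrix (Gpq p q (k - 1))).det := by
  obtain ⟨m, rfl⟩ : ∃ m, q = m + 1 := ⟨q - 1, by omega⟩
  obtain ⟨n, rfl⟩ : ∃ n, k = n + 1 := ⟨k - 1, by omega⟩
  have hH := cyc_connected m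
  have hR := lollipop_connected p n hp
  rw [Nat.add_sub_cancel,
    det_distMatrix_of_iso (glue_connected hH hR _) (inftyGraphIso p m n hp (by omega)),
    det_distMatrix_of_iso (glue_connected hH hR _) (GpqIso p m n hp (by omega))]
  exact det_distMatrix_glue hH hR _ _
end

section
/- Fix integers p, q ≥ 3 and for each n ≥ 0 let D_n denote the distance matrix of the graph G(p,q;n). Then for every n ≥ 2, det D_n = −4·det D_{n−1} − 4·det D_{n−2}. -/
open SimpleGraph Matrix

/-- Walks in a graph with a pendant vertex contract to the graph without it. -/
theorem dist_lastCases_le_length {m : ℕ} {H : SimpleGraph (Fin m)} {G : SimpleGraph (Fin (m + 1))}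
    (hH : H.Connected) (w : Fin m)
    (hadj : ∀ a b : Fin m, G.Adj a.castSucc b.castSucc ↔ H.Adj a b)
    (hlast : ∀ a : Fin m, G.Adj (Fin.last m) a.castSucc ↔ a = w)
    {u v : Fin (m + 1)} (W : G.Walk u v) :
    H.dist (Fin.lastCases w id u) (Fin.lastCases w id v) ≤ W.length := by
  induction W with
  | nil => simp
  | @cons x y z h W ih =>
    have hxy : H.dist (Fin.lastCases w id x) (Fin.lastCases w id y) ≤ 1 := by
      induction x using Fin.lastCases with
      | last =>
        induction y using Fin.lastCases with
        | last => simp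
        | cast b => simp [(hlast b).1 h]
      | cast a =>
        induction y using Fin.lastCases with
        | last => simp [(hlast a).1 h.symm]
        | cast b => simp [SimpleGraph.dist_eq_one_iff_adj.2 ((hadj a b).1 h)]
    rw [SimpleGraph.Walk.length_cons]
    have := hH.dist_triangle (u := Fin.lastCases w id x) (v := Fin.lastCases w id y)
      (w := Fin.lastCases w id z)
    omega

/-- Attaching a pendant vertex does not change the other distances. -/
theorem dist_castSucc_castSucc {m : ℕ} {H : SimpleGraph (Fin m)} {G : SimpleGraph (Fin (m + 1))}
    (hH : H.Connected) (hG : G.Connected) (w : Fin m)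
    (hadj : ∀ a b : Fin m, G.Adj a.castSucc b.castSucc ↔ H.Adj a b)
    (hlast : ∀ a : Fin m, G.Adj (Fin.last m) a.castSucc ↔ a = w) (a b : Fin m) :
    G.dist a.castSucc b.castSucc = H.dist a b := by
  apply le_antisymm
  · obtain ⟨W, hW⟩ := hH.exists_walk_length_eq_dist a b
    let f : H →g G := ⟨Fin.castSucc, fun h => (hadj _ _).2 h⟩
    rw [← hW, ← W.length_map f]
    exact SimpleGraph.dist_le _
  · obtain ⟨W, hW⟩ := hG.exists_walk_length_eq_dist a.castSucc b.castSucc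
    have := dist_lastCases_le_length hH w hadj hlast W
    simpa [hW] using this

/-- Every shortest path to a pendant vertex passes through its neighbour. -/
theorem dist_castSucc_last {m : ℕ} {H : SimpleGraph (Fin m)} {G : SimpleGraph (Fin (m + 1))}
    (hH : H.Connected) (hG : G.Connected) (w : Fin m)
    (hadj : ∀ a b : Fin m, G.Adj a.castSucc b.castSucc ↔ H.Adj a b)
    (hlast : ∀ a : Fin m, G.Adj (Fin.last m) a.castSucc ↔ a = w) (a : Fin m) :
    G.dist a.castSucc (Fin.last m) = H.dist a w + 1 := by
  apply le_antisymm
  · have h := hG.dist_triangle (u := a.castSucc) (v := w.castSucc) (w := Fin.last m)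
    rwa [dist_castSucc_castSucc hH hG w hadj hlast,
      SimpleGraph.dist_eq_one_iff_adj.2 ((hlast w).2 rfl).symm] at h
  · obtain ⟨W, hW⟩ := hG.exists_walk_length_eq_dist (Fin.last m) a.castSucc
    rw [SimpleGraph.dist_comm, SimpleGraph.dist_comm (u := a.castSucc), ← hW]
    generalize hv : a.castSucc = v at W
    cases W with
    | nil => exact absurd hv (Fin.castSucc_ne_last a)
    | @cons _ y _ h W =>
      subst hv
      have hle := dist_lastCases_le_length hH w hadj hlast W
      induction y using Fin.lastCases with
      | last => exact absurd h (G.loopless.irrefl _)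
      | cast b =>
        obtain rfl := (hlast b).1 h
        simpa using hle

theorem det_eq_of_last_row_col {R : Type*} [CommRing R] {m : ℕ}
    (A : Matrix (Fin (m + 2)) (Fin (m + 2)) R) (c : R)
    (hrow : ∀ j : Fin m, A (Fin.last _) j.castSucc.castSucc = 0)
    (hrow' : A (Fin.last _) (Fin.last m).castSucc = c)
    (hcol : ∀ i : Fin m, A i.castSucc.castSucc (Fin.last _) = 0)
    (hcol' : A (Fin.last m).castSucc (Fin.last _) = c) :
    A.det = A (Fin.last _) (Fin.last _) * (A.submatrix Fin.castSucc Fin.castSucc).det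
      - c ^ 2 * (A.submatrix (fun i : Fin m => i.castSucc.castSucc)
          (fun i : Fin m => i.castSucc.castSucc)).det := by
  rw [Matrix.det_succ_row A (Fin.last _), Fin.sum_univ_castSucc, Fin.sum_univ_castSucc]
  rw [Finset.sum_eq_zero (fun j _ => by rw [hrow j]; ring), hrow']
  rw [Matrix.det_succ_column (A.submatrix _ (Fin.last m).castSucc.succAbove) (Fin.last _),
    Fin.sum_univ_castSucc]
  have hsucc : (Fin.last m).castSucc.succAbove (Fin.last m) = Fin.last (m + 1) := by
    rw [Fin.succAbove_castSucc_self, Fin.succ_last]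
  rw [Finset.sum_eq_zero (fun i _ => by
    rw [Matrix.submatrix_apply, hsucc, Fin.succAbove_last, hcol i]; ring)]
  rw [Matrix.submatrix_apply, hsucc, Fin.succAbove_last, hcol', Matrix.submatrix_submatrix]
  have hcomp : (Fin.last m).castSucc.succAbove ∘ (Fin.last m).succAbove
      = fun i : Fin m => i.castSucc.castSucc := by
    funext i
    simp [Fin.succAbove_last, Fin.succAbove_castSucc_of_lt, Fin.castSucc_lt_last]
  have hcomp' : (Fin.castSucc ∘ (Fin.last m).succAbove : Fin m → Fin (m + 2))
      = fun i : Fin m => i.castSucc.castSucc := by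
    funext i
    simp [Fin.succAbove_last]
  have hsign (k : ℕ) : (-1 : R) ^ (k + k) = 1 := Even.neg_one_pow ⟨k, rfl⟩
  rw [hcomp, hcomp']
  simp only [Fin.val_last, Fin.val_castSucc, hsign]
  rw [show m + 1 + m = (m + m) + 1 by ring, pow_succ, hsign]
  ring

/-- Second differences reduce the determinant of the distance matrix of a graph with a pendant
path on two vertices. -/
theorem det_of_pendant_path {R : Type*} [CommRing R] {m : ℕ} (w : Fin m)
    (A : Matrix (Fin (m + 2)) (Fin (m + 2)) R) (B : Matrix (Fin (m + 1)) (Fin (m + 1)) R)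
    (C : Matrix (Fin m) (Fin m) R) (hA : A.IsSymm) (hC : C w w = 0)
    (hAB : ∀ i j, A i.castSucc j.castSucc = B i j)
    (hA' : ∀ i, A i.castSucc (Fin.last _) = B i (Fin.last _) + 1)
    (hA0 : A (Fin.last _) (Fin.last _) = 0)
    (hBC : ∀ i j, B i.castSucc j.castSucc = C i j)
    (hB' : ∀ i, B i.castSucc (Fin.last _) = C i w + 1)
    (hB0 : B (Fin.last _) (Fin.last _) = 0) :
    A.det = -4 * B.det - 4 * C.det := by
  set l := Fin.last (m + 1)
  set k := (Fin.last m).castSucc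
  set x := w.castSucc.castSucc
  have hkl : k ≠ l := Fin.castSucc_ne_last _
  have hxl : x ≠ l := Fin.castSucc_ne_last _
  have hlB (j) : A l j.castSucc = B j (Fin.last _) + 1 := by rw [← hA.apply, hA']
  have hBs (i j) : B i j = B j i := by rw [← hAB, ← hAB, hA.apply]
  have hkB (j) : B (Fin.last _) j.castSucc = C j w + 1 := by rw [hBs, hB']
  have hCs (i j) : C i j = C j i := by rw [← hBC, ← hBC, hBs]
  let r : Fin (m + 2) → R := fun j => A l j + (-2) * A k j + A x j
  let A₁ := A.updateRow l r
  have h1 : A₁.det = A.det := by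
    rw [← Matrix.det_updateRow_add_smul_self A hkl.symm (-2),
      ← Matrix.det_updateRow_add_smul_self (A.updateRow l (A l + (-2 : R) • A k)) hxl.symm 1]
    congr 1
    ext i j
    by_cases hi : i = l
    · subst hi
      simp [A₁, r, hxl]
    · simp [A₁, Matrix.updateRow_apply, hi]
  let c : Fin (m + 2) → R := fun i => A₁ i l + (-2) * A₁ i k + A₁ i x
  let A₂ := A₁.updateCol l c
  have h2 : A₂.det = A₁.det := by
    rw [← Matrix.det_updateCol_add_smul_self A₁ hkl.symm (-2),
      ← Matrix.det_updateCol_add_smul_self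
        (A₁.updateCol l (fun i => A₁ i l + (-2 : R) • A₁ i k)) hxl.symm 1]
    congr 1
    ext i j
    by_cases hj : j = l
    · subst hj
      simp [A₂, c, hxl]
    · simp [A₂, Matrix.updateCol_apply, hj]
  have hr (j : Fin m) : r j.castSucc.castSucc = 0 := by
    simp only [r, l, k, x, hlB, hAB, hB', hBC, hkB, hCs w j]; ring
  have hrk : r k = 2 := by
    simp only [r, l, k, x, hlB, hAB, hB', hB0, hC]; ring
  have hrl : r l = 0 := by
    simp only [r, l, k, x, hA', hA0, hB', hB0, hC]; ring
  have hA₁l (j) : A₁ l j = r j := by simp [A₁]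
  have hA₁ (i : Fin (m + 1)) (j) : A₁ i.castSucc j = A i.castSucc j := by
    simp [A₁, l, Matrix.updateRow_apply, Fin.castSucc_ne_last]
  have hA₂l (i) : A₂ i l = c i := by simp [A₂]
  have hA₂ (i) (j : Fin (m + 1)) : A₂ i j.castSucc = A₁ i j.castSucc := by
    simp [A₂, l, Fin.castSucc_ne_last]
  rw [← h1, ← h2, det_eq_of_last_row_col A₂ 2]
  · have hB : A₂.submatrix Fin.castSucc Fin.castSucc = B := by
      ext i j
      simp [hA₂, hA₁, hAB]
    have hC' : A₂.submatrix (fun i : Fin m => i.castSucc.castSucc)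
        (fun i : Fin m => i.castSucc.castSucc) = C := by
      ext i j
      simp [hA₂, hA₁, hAB, hBC]
    have hll : A₂ l l = -4 := by
      simp only [hA₂l, c, hA₁l, hrk, hrl, x, hr]; ring
    rw [hB, hC', hll]
    ring
  · intro j
    rw [hA₂, hA₁l, hr]
  · rw [hA₂, hA₁l, hrk]
  · intro i
    simp only [hA₂l, c, hA₁, l, k, x, hA', hAB, hB', hBC]; ring
  · simp only [hA₂l, c, hA₁, l, k, x, hA', hAB, hB0, hkB, hC]; ring

theorem Gpq_adj_iff {p q n : ℕ} (a b : Fin (p + q - 1 + n)) {i j : ℕ} (hi : (a : ℕ) = i)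
    (hj : (b : ℕ) = j) :
    (Gpq p q n).Adj a b ↔ i ≠ j ∧
      (((i + 1 = j ∧ j < p) ∨ (i = 0 ∧ j = p - 1) ∨ (i = 0 ∧ j = p) ∨
        (p ≤ i ∧ i + 1 = j ∧ j ≤ p + q - 2) ∨ (i = 0 ∧ j = p + q - 2) ∨
        (1 ≤ n ∧ i = 0 ∧ j = p + q - 1) ∨ (p + q - 1 ≤ i ∧ i + 1 = j)) ∨
      ((j + 1 = i ∧ i < p) ∨ (j = 0 ∧ i = p - 1) ∨ (j = 0 ∧ i = p) ∨
        (p ≤ j ∧ j + 1 = i ∧ i ≤ p + q - 2) ∨ (j = 0 ∧ i = p + q - 2) ∨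
        (1 ≤ n ∧ j = 0 ∧ i = p + q - 1) ∨ (p + q - 1 ≤ j ∧ j + 1 = i))) := by
  subst hi hj
  simp only [Gpq, SimpleGraph.fromRel_adj, ne_eq, Fin.ext_iff]

theorem Gpq_connected {p q : ℕ} (hp : 3 ≤ p) (hq : 3 ≤ q) (n : ℕ) : (Gpq p q n).Connected := by
  have hpos : 0 < p + q - 1 + n := by omega
  have key : ∀ (k : ℕ) (hk : k < p + q - 1 + n), (Gpq p q n).Reachable ⟨0, hpos⟩ ⟨k, hk⟩ := by
    intro k
    induction k using Nat.strong_induction_on with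
    | _ k ih =>
      intro hk
      by_cases h0 : k = 0
      · subst h0
        exact SimpleGraph.Reachable.refl _
      by_cases hc : k = p ∨ k = p + q - 1
      · refine SimpleGraph.Adj.reachable ((Gpq_adj_iff _ _ rfl rfl).2 ⟨Ne.symm h0, Or.inl ?_⟩)
        rcases hc with hc | hc
        · exact Or.inr (Or.inr (Or.inl ⟨rfl, hc⟩))
        · exact Or.inr (Or.inr (Or.inr (Or.inr (Or.inr (Or.inl ⟨by omega, rfl, hc⟩)))))
      · push Not at hc
        refine (ih (k - 1) (by omega) (by omega)).trans (SimpleGraph.Adj.reachable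
          ((Gpq_adj_iff _ _ rfl rfl).2 ⟨show k - 1 ≠ k by omega, Or.inl ?_⟩))
        have hk1 : k - 1 + 1 = k := by omega
        rcases lt_or_ge k p with h | h
        · exact Or.inl ⟨hk1, h⟩
        rcases le_or_gt k (p + q - 2) with h' | h'
        · exact Or.inr (Or.inr (Or.inr (Or.inl ⟨show p ≤ k - 1 by omega, hk1, h'⟩)))
        · exact Or.inr (Or.inr (Or.inr (Or.inr (Or.inr (Or.inr
            ⟨show p + q - 1 ≤ k - 1 by omega, hk1⟩)))))
  have : Nonempty (Fin (p + q - 1 + n)) := ⟨⟨0, hpos⟩⟩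
  exact ⟨fun u v => (key u u.2).symm.trans (key v v.2)⟩

theorem Gpq_succ_adj_castSucc {p q : ℕ} (n : ℕ) (a b : Fin (p + q - 1 + n)) :
    (Gpq p q (n + 1)).Adj a.castSucc b.castSucc ↔ (Gpq p q n).Adj a b := by
  have ha := a.2
  have hb := b.2
  rw [Gpq_adj_iff a b rfl rfl, Gpq_adj_iff (n := n + 1) _ _ (Fin.val_castSucc a) (Fin.val_castSucc b)]
  have h {i : ℕ} (hi : i < p + q - 1 + n) (k : ℕ) :
      (1 ≤ n + 1 ∧ k = 0 ∧ i = p + q - 1) ↔ (1 ≤ n ∧ k = 0 ∧ i = p + q - 1) := by omega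
  rw [h ha, h hb]

theorem Gpq_one_adj_last {p q : ℕ} (hp : 3 ≤ p) (hq : 3 ≤ q) (a : Fin (p + q - 1 + 0)) :
    (Gpq p q 1).Adj (Fin.last (p + q - 1 + 0)) a.castSucc ↔ a = ⟨0, by omega⟩ := by
  have ha := a.2
  rw [Gpq_adj_iff (n := 1) _ _ (Fin.val_last (p + q - 1 + 0)) (Fin.val_castSucc a), Fin.ext_iff]
  generalize (a : ℕ) = i at *
  constructor
  · rintro ⟨-, (h | h | h | h | h | h | h) | (h | h | h | h | h | h | h)⟩ <;> dsimp only <;> omega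
  · rintro rfl
    exact ⟨by omega, Or.inr (Or.inr (Or.inr (Or.inr (Or.inr (Or.inr (Or.inl
      ⟨le_rfl, rfl, rfl⟩))))))⟩

theorem Gpq_add_two_adj_last {p q : ℕ} (hp : 3 ≤ p) (hq : 3 ≤ q) (n : ℕ)
    (a : Fin (p + q - 1 + (n + 1))) :
    (Gpq p q (n + 2)).Adj (Fin.last (p + q - 1 + (n + 1))) a.castSucc ↔
      a = Fin.last (p + q - 1 + n) := by
  have ha := a.2
  rw [Gpq_adj_iff (n := n + 2) _ _ (Fin.val_last (p + q - 1 + (n + 1))) (Fin.val_castSucc a),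
    Fin.ext_iff, Fin.val_last (p + q - 1 + n)]
  generalize (a : ℕ) = i at *
  constructor
  · rintro ⟨-, (h | h | h | h | h | h | h) | (h | h | h | h | h | h | h)⟩ <;> omega
  · rintro rfl
    exact ⟨by omega, Or.inr (Or.inr (Or.inr (Or.inr (Or.inr (Or.inr (Or.inr
      ⟨by omega, by omega⟩))))))⟩

theorem exists_Gpq_succ_adj_last {p q : ℕ} (hp : 3 ≤ p) (hq : 3 ≤ q) (n : ℕ) :
    ∃ w : Fin (p + q - 1 + n), ∀ a : Fin (p + q - 1 + n),
      (Gpq p q (n + 1)).Adj (Fin.last _) a.castSucc ↔ a = w := by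
  cases n with
  | zero => exact ⟨_, Gpq_one_adj_last hp hq⟩
  | succ n => exact ⟨_, Gpq_add_two_adj_last hp hq n⟩

/-- Fix `p, q ≥ 3` and write `D_n` for the distance matrix of `G(p,q;n)`.  Then
for every `n ≥ 2`, `det D_n = -4 det D_{n-1} - 4 det D_{n-2}`. -/
theorem det_distMatrix_Gpq_recurrence (p q : ℕ) (hp : 3 ≤ p) (hq : 3 ≤ q) :
    ∀ n : ℕ, 2 ≤ n →
      (distMatrix (Gpq p q n)).det =
        -4 * (distMatrix (Gpq p q (n - 1))).det
          - 4 * (distMatrix (Gpq p q (n - 2))).det := by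
  intro n hn
  obtain ⟨n, rfl⟩ := Nat.exists_eq_add_of_le' hn
  obtain ⟨w, hw⟩ := exists_Gpq_succ_adj_last hp hq n
  have hconn := Gpq_connected hp hq
  have hadj := fun n => Gpq_succ_adj_castSucc (p := p) (q := q) n
  have hlast := Gpq_add_two_adj_last hp hq n
  refine det_of_pendant_path w (distMatrix (Gpq p q (n + 2))) (distMatrix (Gpq p q (n + 1)))
    (distMatrix (Gpq p q n)) ?_ ?_ ?_ ?_ ?_ ?_ ?_ ?_
  · ext i j
    simp [distMatrix, SimpleGraph.dist_comm]
  · simp [distMatrix]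
  · intro i j
    exact congrArg Nat.cast
      (dist_castSucc_castSucc (hconn (n + 1)) (hconn (n + 2)) _ (hadj _) hlast i j)
  · intro i
    exact (congrArg Nat.cast
      (dist_castSucc_last (hconn (n + 1)) (hconn (n + 2)) _ (hadj _) hlast i)).trans
      (Nat.cast_succ _)
  · simp [distMatrix]
  · intro i j
    exact congrArg Nat.cast
      (dist_castSucc_castSucc (hconn n) (hconn (n + 1)) w (hadj _) hw i j)
  · intro i
    exact (congrArg Nat.cast
      (dist_castSucc_last (hconn n) (hconn (n + 1)) w (hadj _) hw i)).trans (Nat.cast_succ _)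
  · simp [distMatrix]
end
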